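/- Let S_n (n ≥ 3) be the bidirectional Sun graph with all edge weights equal: a bidirected cycle on n center vertices, together with, for each center vertex, one pendant leaf joined to it by edges in both directions. Then ept_rzf(S_n) = 1 + (3/2)(n − 1). -/

import Mathlib

open scoped ENNReal NNReal

namespace RZF

variable {V : Type*} [Fintype V] [DecidableEq V]

/-- Probability that the white vertex `x` turns blue in one round of weighted
randomized zero forcing with weights `w`, given the current blue set `B`
(`0` when the total incoming weight of `x` is `0`). -/
noncomputable def turnProb (w : V → V → ℝ≥0) (B : Finset V) (x : V) : ℝ≥0 :=
  (∑ u ∈ B, w u x) / ∑ u, w u x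

/-- One-round transition probability of the RZF Markov chain from blue set `B`
to blue set `C`: each white vertex independently turns blue with probability
`turnProb w B ·`, and blue vertices stay blue. -/
noncomputable def stepProb (w : V → V → ℝ≥0) (B C : Finset V) : ℝ≥0∞ :=
  if B ⊆ C then
    (∏ x ∈ C \ B, (turnProb w B x : ℝ≥0∞)) *
      ∏ x ∈ Cᶜ, (1 - (turnProb w B x : ℝ≥0∞))
  else 0

/-- Distribution of the blue set after `t` rounds, started from `S`. -/
noncomputable def state (w : V → V → ℝ≥0) (S : Finset V) : ℕ → Finset V → ℝ≥0∞
  | 0 => fun C => if C = S then 1 else 0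
  | t + 1 => fun C => ∑ B : Finset V, state w S t B * stepProb w B C

/-- Expected propagation time `∑ₜ P(Bₜ ≠ V(G))`; this equals `E[τ]` when the
all-blue state is reachable from `S`, and `∞` otherwise. -/
noncomputable def ept (w : V → V → ℝ≥0) (S : Finset V) : ℝ≥0∞ :=
  ∑' t : ℕ, ∑ C ∈ Finset.univ.filter (fun C : Finset V => C ≠ Finset.univ),
    state w S t C

/-- Minimum expected propagation time over singleton starting sets. -/
noncomputable def eptMin (w : V → V → ℝ≥0) : ℝ≥0∞ :=
  ⨅ v : V, ept w {v}

/-- The weight function of an unweighted directed graph: weight `1` on each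
edge and `0` otherwise, so that `turnProb` is the fraction of in-neighbors
that are blue. -/
def unweight (adj : V → V → Prop) [DecidableRel adj] : V → V → ℝ≥0 :=
  fun u v => if adj u v then 1 else 0

end RZF

/-- `reachIn adj t a b` : there is a directed path of length at most `t`
from `a` to `b` in the directed graph with adjacency relation `adj`. -/
def reachIn {V : Type*} (adj : V → V → Prop) : ℕ → V → V → Prop
  | 0, a, b => a = b
  | t + 1, a, b => reachIn adj t a b ∨ ∃ c, reachIn adj t a c ∧ adj c b

/-- The weight function of the bidirectional Sun graph with `n` centers, all
edges of the same positive weight `c`: `Sum.inl i` is the `i`-th center vertex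
(the centers form a bidirected cycle) and `Sum.inr i` is the pendant leaf
attached to center `i`. -/
noncomputable def sunWeight (n : ℕ) (c : ℝ≥0) :
    (Fin n ⊕ Fin n) → (Fin n ⊕ Fin n) → ℝ≥0
  | Sum.inl i, Sum.inl j =>
      if (j : ℕ) = ((i : ℕ) + 1) % n ∨ (i : ℕ) = ((j : ℕ) + 1) % n then c else 0
  | Sum.inl i, Sum.inr j => if i = j then c else 0
  | Sum.inr i, Sum.inl j => if i = j then c else 0
  | Sum.inr _, Sum.inr _ => 0

namespace RZF

section Chain

variable {V : Type*} [Fintype V] [DecidableEq V]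

/-- The indicator that the blue set `B` is not yet everything. -/
noncomputable def notFull (B : Finset V) : ℝ≥0∞ := if B = Finset.univ then 0 else 1

theorem notFull_le_one (B : Finset V) : notFull B ≤ 1 := by
  unfold notFull; split_ifs <;> simp

theorem ept_eq_tsum_notFull (w : V → V → ℝ≥0) (S : Finset V) :
    ept w S = ∑' t, ∑ C, state w S t C * notFull C := by
  refine tsum_congr fun t => ?_
  rw [Finset.sum_filter]
  refine Finset.sum_congr rfl fun C _ => ?_
  by_cases h : C = Finset.univ <;> simp [notFull, h]

theorem sum_state_succ (w : V → V → ℝ≥0) (S : Finset V) (t : ℕ) (Φ : Finset V → ℝ≥0∞) :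
    ∑ C, state w S (t + 1) C * Φ C =
      ∑ B, state w S t B * ∑ C, stepProb w B C * Φ C := by
  simp only [state, Finset.sum_mul, Finset.mul_sum]
  rw [Finset.sum_comm]
  simp only [mul_assoc]

theorem of_state_ne_zero {w : V → V → ℝ≥0} {S : Finset V} {I : Finset V → Prop} (hS : I S)
    (hI : ∀ B C, I B → stepProb w B C ≠ 0 → I C) (t : ℕ) :
    ∀ B, state w S t B ≠ 0 → I B := by
  induction t with
  | zero =>
    intro B h
    have : B = S := by by_contra hB; simp [state, hB] at h
    exact this ▸ hS
  | succ t ih =>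
    intro C h
    obtain ⟨B, -, hB⟩ := Finset.exists_ne_zero_of_sum_ne_zero h
    exact hI B C (ih B (left_ne_zero_of_mul hB)) (right_ne_zero_of_mul hB)

/-- Foster-type upper bound: a potential which drops by at least one in expectation per round
bounds the expected propagation time from above. -/
theorem ept_le_of_drift {w : V → V → ℝ≥0} {S : Finset V} {I : Finset V → Prop} (hS : I S)
    (hI : ∀ B C, I B → stepProb w B C ≠ 0 → I C) {Φ : Finset V → ℝ≥0∞}
    (hΦ : ∀ B, I B → ∑ C, stepProb w B C * Φ C + notFull B ≤ Φ B) :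
    ept w S ≤ Φ S := by
  have key : ∀ T : ℕ, ∑ t ∈ Finset.range T, ∑ C, state w S t C * notFull C +
      ∑ C, state w S T C * Φ C ≤ Φ S := by
    intro T
    induction T with
    | zero => simp [state]
    | succ T ih =>
      refine le_trans ?_ ih
      rw [Finset.sum_range_succ, add_assoc, sum_state_succ, ← Finset.sum_add_distrib]
      gcongr with B
      rw [← mul_add, add_comm]
      by_cases h : state w S T B = 0
      · simp [h]
      · gcongr
        exact hΦ B (of_state_ne_zero hS hI T B h)
  rw [ept_eq_tsum_notFull]
  exact ENNReal.tsum_le_of_sum_range_le fun T => le_self_add.trans (key T)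

/-- Foster-type lower bound: a bounded potential which drops by at most one in expectation per
round bounds the expected propagation time from below. -/
theorem le_ept_of_drift {w : V → V → ℝ≥0} {S : Finset V} {I : Finset V → Prop} (hS : I S)
    (hI : ∀ B C, I B → stepProb w B C ≠ 0 → I C) {Φ : Finset V → ℝ≥0∞} {K : ℝ≥0∞}
    (hK : K ≠ ⊤) (hΦK : ∀ B, Φ B ≤ notFull B * K)
    (hΦ : ∀ B, I B → Φ B ≤ ∑ C, stepProb w B C * Φ C + notFull B) :
    Φ S ≤ ept w S := by
  have key : ∀ T : ℕ, Φ S ≤ ∑ t ∈ Finset.range T, ∑ C, state w S t C * notFull C +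
      ∑ C, state w S T C * Φ C := by
    intro T
    induction T with
    | zero => simp [state]
    | succ T ih =>
      refine ih.trans ?_
      rw [Finset.sum_range_succ, add_assoc, sum_state_succ, ← Finset.sum_add_distrib]
      gcongr with B
      rw [← mul_add, add_comm]
      by_cases h : state w S T B = 0
      · simp [h]
      · gcongr
        exact hΦ B (of_state_ne_zero hS hI T B h)
  rw [ept_eq_tsum_notFull]
  by_cases htop : ∑' t, ∑ C, state w S t C * notFull C = ⊤
  · simp [htop]
  have hlim := (ENNReal.Tendsto.mul_const (b := K)
    (ENNReal.tendsto_atTop_zero_of_tsum_ne_top htop) (Or.inr hK)).const_add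
    (∑' t, ∑ C, state w S t C * notFull C)
  rw [zero_mul, add_zero] at hlim
  refine ge_of_tendsto' hlim fun T => (key T).trans ?_
  refine add_le_add (ENNReal.sum_le_tsum _) ?_
  rw [Finset.sum_mul]
  refine Finset.sum_le_sum fun C _ => ?_
  rw [mul_assoc]
  gcongr
  exact hΦK C

omit [DecidableEq V] in
theorem turnProb_le_one (w : V → V → ℝ≥0) (B : Finset V) (x : V) : turnProb w B x ≤ 1 :=
  div_le_one_of_le₀ (Finset.sum_le_sum_of_subset (Finset.subset_univ B)) zero_le

theorem sum_stepProb_mul_prod (w : V → V → ℝ≥0) (B : Finset V) (a : V → ℝ≥0∞) :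
    ∑ C, stepProb w B C * ∏ x ∈ C \ B, a x =
      ∏ x ∈ Bᶜ, (turnProb w B x * a x + (1 - turnProb w B x)) := by
  rw [Finset.prod_add]
  simp only [stepProb, ite_mul, zero_mul]
  rw [← Finset.sum_filter]
  refine Finset.sum_bij' (fun C _ => C \ B) (fun D _ => B ∪ D) ?_ ?_ ?_ ?_ ?_
  · intro C _
    simp only [Finset.mem_powerset]
    intro x hx
    simp_all
  · intro D _
    simp
  · intro C hC
    simp only [Finset.mem_filter, Finset.mem_univ, true_and] at hC
    exact Finset.union_sdiff_of_subset hC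
  · intro D hD
    ext x
    have := @Finset.mem_powerset _ D Bᶜ |>.1 hD
    have hx := @this x
    simp at hx ⊢
    tauto
  · intro C hC
    simp only [Finset.mem_filter, Finset.mem_univ, true_and] at hC
    rw [Finset.prod_mul_distrib, mul_right_comm]
    congr 2
    ext x
    have := @hC x
    simp
    tauto

theorem sum_stepProb (w : V → V → ℝ≥0) (B : Finset V) : ∑ C, stepProb w B C = 1 := by
  have h := sum_stepProb_mul_prod w B (fun _ => 1)
  simp only [Finset.prod_const_one, mul_one] at h
  rw [h]
  refine Finset.prod_eq_one fun x _ => add_tsub_cancel_of_le ?_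
  exact_mod_cast turnProb_le_one w B x

theorem subset_of_stepProb_ne_zero {w : V → V → ℝ≥0} {B C : Finset V}
    (h : stepProb w B C ≠ 0) : B ⊆ C := by
  by_contra hBC
  simp [stepProb, hBC] at h

theorem sum_stepProb_not_mem (w : V → V → ℝ≥0) (B : Finset V) (x : V) :
    ∑ C, stepProb w B C * (if x ∈ C then 0 else 1) =
      if x ∈ B then 0 else 1 - (turnProb w B x : ℝ≥0∞) := by
  split_ifs with hx
  · refine Finset.sum_eq_zero fun C _ => ?_
    by_cases h : stepProb w B C = 0
    · simp [h]
    · simp [subset_of_stepProb_ne_zero h hx]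
  · have h := sum_stepProb_mul_prod w B (fun y => if y = x then 0 else 1)
    rw [Finset.prod_eq_single x] at h
    · simp only [if_true, mul_zero, zero_add] at h
      rw [← h]
      refine Finset.sum_congr rfl fun C _ => ?_
      congr 1
      split_ifs with hC
      · exact (Finset.prod_eq_zero (i := x) (by simp [hx, hC]) (by simp)).symm
      · refine (Finset.prod_eq_one fun y hy => ?_).symm
        have : y ≠ x := by rintro rfl; simp_all
        simp [this]
    · intro y _ hy
      simp only [hy, if_false, mul_one]
      exact add_tsub_cancel_of_le (by exact_mod_cast turnProb_le_one w B y)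
    · intro h'; simp [hx] at h'

theorem exists_weight_ne_zero_of_stepProb_ne_zero {w : V → V → ℝ≥0} {B C : Finset V} {x : V}
    (h : stepProb w B C ≠ 0) (hxC : x ∈ C) (hxB : x ∉ B) : ∃ u ∈ B, w u x ≠ 0 := by
  have hBC := subset_of_stepProb_ne_zero h
  rw [stepProb, if_pos hBC] at h
  have := Finset.prod_ne_zero_iff.1 (left_ne_zero_of_mul h) x (by simp [hxC, hxB])
  rw [ENNReal.coe_ne_zero, turnProb] at this
  exact Finset.exists_ne_zero_of_sum_ne_zero (fun h0 => this (by simp [h0]))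
    |>.imp fun u hu => hu

theorem turnProb_ne_one_of_stepProb_ne_zero {w : V → V → ℝ≥0} {B C : Finset V} {x : V}
    (h : stepProb w B C ≠ 0) (hxC : x ∉ C) : turnProb w B x ≠ 1 := by
  have hBC := subset_of_stepProb_ne_zero h
  rw [stepProb, if_pos hBC] at h
  intro h1
  exact Finset.prod_ne_zero_iff.1 (right_ne_zero_of_mul h) x (by simp [hxC]) (by simp [h1])

end Chain

section Sun

open Sum

variable {n : ℕ} [NeZero n] {c : ℝ≥0}

theorem sunWeight_inl_inl (i j : Fin n) :
    sunWeight n c (inl i) (inl j) = if j = i + 1 ∨ i = j + 1 then c else 0 := by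
  simp [sunWeight, Fin.ext_iff, Fin.val_add]

theorem sub_one_ne_add_one (hn : 3 ≤ n) (x : Fin n) : x - 1 ≠ x + 1 := by
  intro h
  have h2 : (1 : Fin n) + 1 = 0 := by
    have := congrArg (fun y => y - (x - 1)) h
    simp only [sub_self] at this
    rw [this]; abel
  have := congrArg Fin.val h2
  rw [Fin.val_add, Fin.val_one', Nat.mod_eq_of_lt (by omega : 1 < n),
    Nat.mod_eq_of_lt (by omega)] at this
  simp at this

/-- Incoming weight of a center from the blue set. -/
theorem sum_sunWeight_inl (hn : 3 ≤ n) (B : Finset (Fin n ⊕ Fin n)) (x : Fin n) :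
    ∑ u ∈ B, sunWeight n c u (inl x) =
      ((if inl (x - 1) ∈ B then 1 else 0) + (if inl (x + 1) ∈ B then 1 else 0) +
        (if inr x ∈ B then 1 else 0)) * c := by
  have hw : ∀ i, (if inl i ∈ B then sunWeight n c (inl i) (inl x) else 0) =
      (if i = x - 1 then (if inl i ∈ B then c else 0) else 0) +
        (if i = x + 1 then (if inl i ∈ B then c else 0) else 0) := by
    intro i
    have h1 := sub_one_ne_add_one hn x
    rw [sunWeight_inl_inl]
    have h2 : x = i + 1 ↔ i = x - 1 := by rw [eq_sub_iff_add_eq, eq_comm]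
    simp only [h2]
    by_cases ha : i = x - 1
    · subst ha; simp [h1]
    · simp [ha, ← ite_and, and_comm]
  have hl : ∀ i, (if inr i ∈ B then sunWeight n c (inr i) (inl x) else 0) =
      (if i = x then (if inr i ∈ B then c else 0) else 0) := by
    intro i
    simp [sunWeight, ← ite_and, and_comm]
  rw [← Finset.univ_inter B, ← Finset.sum_ite_mem, Fintype.sum_sum_type]
  simp only [hw, hl, Finset.sum_add_distrib, Finset.sum_ite_eq', Finset.mem_univ, if_true]
  simp [add_mul]

theorem turnProb_sun_inl (hn : 3 ≤ n) (hc : 0 < c) (B : Finset (Fin n ⊕ Fin n)) (x : Fin n) :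
    turnProb (sunWeight n c) B (inl x) =
      ((if inl (x - 1) ∈ B then 1 else 0) + (if inl (x + 1) ∈ B then 1 else 0) +
        (if inr x ∈ B then 1 else 0)) / 3 := by
  rw [turnProb, sum_sunWeight_inl hn, sum_sunWeight_inl hn, mul_div_mul_right _ _ hc.ne']
  norm_num

omit [NeZero n] in
theorem turnProb_sun_inr (hc : 0 < c) (B : Finset (Fin n ⊕ Fin n)) (x : Fin n) :
    turnProb (sunWeight n c) B (inr x) = if inl x ∈ B then 1 else 0 := by
  have h : ∀ B : Finset (Fin n ⊕ Fin n),
      ∑ u ∈ B, sunWeight n c u (inr x) = if inl x ∈ B then c else 0 := by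
    intro B
    rw [← Finset.univ_inter B, ← Finset.sum_ite_mem, Fintype.sum_sum_type]
    simp only [sunWeight, ite_self, Finset.sum_const_zero, add_zero, ← ite_and]
    simp only [and_comm, ite_and]
    simp
  rw [turnProb, h, h]
  split_ifs <;> simp_all [hc.ne']

/-- Expected number of centers turning blue in the next round. -/
noncomputable def centerDrift (c : ℝ≥0) (B : Finset (Fin n ⊕ Fin n)) : ℝ≥0 :=
  ∑ x : Fin n, if inl x ∈ B then 0 else turnProb (sunWeight n c) B (inl x)

theorem centerDrift_eq (hn : 3 ≤ n) (hc : 0 < c) (B : Finset (Fin n ⊕ Fin n)) :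
    centerDrift c B = (((Finset.univ.filter fun x => inl x ∉ B ∧ inl (x - 1) ∈ B).card +
      (Finset.univ.filter fun x => inl x ∉ B ∧ inl (x + 1) ∈ B).card +
      (Finset.univ.filter fun x => inl x ∉ B ∧ inr x ∈ B).card : ℕ) : ℝ≥0) / 3 := by
  simp only [centerDrift, turnProb_sun_inl hn hc, Finset.card_filter, Nat.cast_add, Nat.cast_sum,
    ← Finset.sum_add_distrib, Finset.sum_div]
  refine Finset.sum_congr rfl fun x _ => ?_
  by_cases h : inl x ∈ B <;> simp [h]

/-- The potential: `3 / 2` per white center, plus one while some vertex is white. -/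
noncomputable def sunPotential (B : Finset (Fin n ⊕ Fin n)) : ℝ≥0∞ :=
  3 / 2 * (∑ x : Fin n, if inl x ∈ B then 0 else 1) + notFull B

omit [NeZero n] in
theorem sunPotential_univ : sunPotential (Finset.univ : Finset (Fin n ⊕ Fin n)) = 0 := by
  simp [sunPotential, notFull]

omit [NeZero n] in
theorem expected_sunPotential (B : Finset (Fin n ⊕ Fin n)) :
    ∑ C, stepProb (sunWeight n c) B C * sunPotential C + 3 / 2 * centerDrift c B =
      3 / 2 * (∑ x : Fin n, if inl x ∈ B then 0 else 1) +
        ∑ C, stepProb (sunWeight n c) B C * notFull C := by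
  have h : ∑ C, stepProb (sunWeight n c) B C * sunPotential C =
      3 / 2 * (∑ x : Fin n, if inl x ∈ B then 0 else
        1 - (turnProb (sunWeight n c) B (inl x) : ℝ≥0∞)) +
        ∑ C, stepProb (sunWeight n c) B C * notFull C := by
    simp only [sunPotential, mul_add, Finset.sum_add_distrib]
    congr 1
    simp only [← sum_stepProb_not_mem]
    rw [Finset.sum_comm, Finset.mul_sum]
    refine Finset.sum_congr rfl fun C _ => ?_
    rw [mul_left_comm, Finset.mul_sum]
  rw [h, add_right_comm, ← mul_add, centerDrift, ENNReal.ofNNReal_finsetSum,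
    ← Finset.sum_add_distrib]
  congr 2
  refine Finset.sum_congr rfl fun x _ => ?_
  split_ifs
  · simp
  · exact tsub_add_cancel_of_le (by exact_mod_cast turnProb_le_one _ _ _)

theorem three_halves_mul_two_thirds : (3 / 2 : ℝ≥0∞) * ((2 / 3 : ℝ≥0) : ℝ≥0∞) = 1 := by
  have : (3 / 2 : ℝ≥0∞) = ((3 / 2 : ℝ≥0) : ℝ≥0∞) := by
    rw [ENNReal.coe_div (by norm_num)]; rfl
  rw [this, ← ENNReal.coe_mul]
  norm_num

open Fin.CommRing in
theorem exists_boundary {P : Fin n → Prop} {v x : Fin n} (hv : P v) (hx : ¬ P x) :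
    (∃ y, ¬ P y ∧ P (y - 1)) ∧ ∃ y, ¬ P y ∧ P (y + 1) := by
  constructor
  · by_contra! h
    have key : ∀ k : ℕ, P (v + k) := by
      intro k
      induction k with
      | zero => simpa using hv
      | succ k ih =>
        by_contra hk
        refine h _ hk ?_
        convert ih using 1
        push_cast; abel
    have := key (x - v).val
    rw [Fin.cast_val_eq_self, add_sub_cancel] at this
    exact hx this
  · by_contra! h
    have key : ∀ k : ℕ, P (v - k) := by
      intro k
      induction k with
      | zero => simpa using hv
      | succ k ih =>
        by_contra hk
        refine h _ hk ?_
        convert ih using 1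
        push_cast; abel
    have := key (v - x).val
    rw [Fin.cast_val_eq_self, sub_sub_cancel] at this
    exact hx this

theorem ept_sun_center_le (hn : 3 ≤ n) (hc : 0 < c) (v : Fin n) :
    ept (sunWeight n c) {inl v} ≤ sunPotential {inl v} := by
  refine ept_le_of_drift (I := fun B => inl v ∈ B) (by simp)
    (fun B C hB h => subset_of_stepProb_ne_zero h hB) fun B hB => ?_
  by_cases hfull : ∀ x : Fin n, inl x ∈ B
  · have h0 : ∑ C, stepProb (sunWeight n c) B C * sunPotential C = 0 := by
      refine Finset.sum_eq_zero fun C _ => ?_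
      by_contra h
      have hs := left_ne_zero_of_mul h
      have hC : C ≠ Finset.univ := by
        rintro rfl; exact right_ne_zero_of_mul h sunPotential_univ
      obtain ⟨x, hx⟩ : ∃ x, x ∉ C := by
        by_contra! h'; exact hC (Finset.eq_univ_iff_forall.2 h')
      rcases x with x | x
      · exact hx (subset_of_stepProb_ne_zero hs (hfull x))
      · exact turnProb_ne_one_of_stepProb_ne_zero hs hx (by simp [turnProb_sun_inr hc, hfull])
    rw [h0, zero_add]
    exact le_add_self
  · push Not at hfull
    obtain ⟨x, hx⟩ := hfull
    obtain ⟨⟨y, hy⟩, z, hz⟩ := exists_boundary (P := fun x => inl x ∈ B) hB hx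
    have hd : (2 / 3 : ℝ≥0) ≤ centerDrift c B := by
      rw [centerDrift_eq hn hc]
      gcongr
      have h1 : 0 < (Finset.univ.filter fun x => inl x ∉ B ∧ inl (x - 1) ∈ B).card :=
        Finset.card_pos.2 ⟨y, by simpa using hy⟩
      have h2 : 0 < (Finset.univ.filter fun x => inl x ∉ B ∧ inl (x + 1) ∈ B).card :=
        Finset.card_pos.2 ⟨z, by simpa using hz⟩
      have : 2 ≤ (Finset.univ.filter fun x => inl x ∉ B ∧ inl (x - 1) ∈ B).card +
        (Finset.univ.filter fun x => inl x ∉ B ∧ inl (x + 1) ∈ B).card +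
        (Finset.univ.filter fun x => inl x ∉ B ∧ inr x ∈ B).card := by omega
      exact_mod_cast this
    have hB1 : notFull B = 1 := if_neg (by rintro rfl; simp at hx)
    rw [hB1, sunPotential, hB1]
    calc _ ≤ ∑ C, stepProb (sunWeight n c) B C * sunPotential C + 3 / 2 * centerDrift c B := by
          rw [← three_halves_mul_two_thirds]
          gcongr
      _ ≤ _ := by
          rw [expected_sunPotential, ← sum_stepProb (sunWeight n c) B]
          gcongr with C
          exact mul_le_of_le_one_right' (notFull_le_one C)

/-- At most one white center has a blue predecessor, and at most one has a blue successor. -/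
def IsArc (B : Finset (Fin n ⊕ Fin n)) : Prop :=
  (∀ x y : Fin n, inl x ∉ B → inl (x - 1) ∈ B → inl y ∉ B → inl (y - 1) ∈ B → x = y) ∧
    ∀ x y : Fin n, inl x ∉ B → inl (x + 1) ∈ B → inl y ∉ B → inl (y + 1) ∈ B → x = y

omit [NeZero n] in
theorem boundary_unique_of_step {P Q : Fin n → Prop} {f g : Fin n → Fin n}
    (hf : f.Injective) (hgf : ∀ x, g (f x) = x) (hPQ : ∀ x, P x → Q x)
    (hnew : ∀ x, Q x → ¬ P x → P (f x) ∨ P (g x))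
    (h : ∀ x y, ¬ P x → P (f x) → ¬ P y → P (f y) → x = y) :
    ∀ x y, ¬ Q x → Q (f x) → ¬ Q y → Q (f y) → x = y := by
  intro x y hx hfx hy hfy
  have hx' := mt (hPQ x) hx
  have hy' := mt (hPQ y) hy
  have h1 := hnew _ hfx
  have h2 := hnew _ hfy
  rw [hgf] at h1 h2
  by_cases hPx : P (f x) <;> by_cases hPy : P (f y)
  · exact h _ _ hx' hPx hy' hPy
  · have := h _ _ hx' hPx hPy (by tauto)
    exact absurd (this ▸ hfy) hx
  · have := h _ _ hy' hPy hPx (by tauto)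
    exact absurd (this ▸ hfx) hy
  · exact hf (h _ _ hPx (by tauto) hPy (by tauto))

/-- The blue sets reachable from a single blue vertex. -/
def SunReachable (B : Finset (Fin n ⊕ Fin n)) : Prop :=
  (IsArc B ∧ ∀ x, inr x ∈ B → inl x ∈ B) ∨ ∃ x, B = {inr x}

omit [NeZero n] in
theorem center_mem_of_leaf_mem {B C : Finset (Fin n ⊕ Fin n)}
    (h : stepProb (sunWeight n c) B C ≠ 0) {x : Fin n} (hC : inr x ∈ C) (hB : inr x ∉ B) :
    inl x ∈ B := by
  obtain ⟨u, hu, hw⟩ := exists_weight_ne_zero_of_stepProb_ne_zero h hC hB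
  rcases u with u | u
  · have : u = x := by by_contra h'; simp [sunWeight, h'] at hw
    exact this ▸ hu
  · simp [sunWeight] at hw

theorem neighbor_mem_of_center_mem {B C : Finset (Fin n ⊕ Fin n)}
    (h : stepProb (sunWeight n c) B C ≠ 0) {x : Fin n} (hC : inl x ∈ C) (hB : inl x ∉ B) :
    inl (x - 1) ∈ B ∨ inl (x + 1) ∈ B ∨ inr x ∈ B := by
  obtain ⟨u, hu, hw⟩ := exists_weight_ne_zero_of_stepProb_ne_zero h hC hB
  rcases u with u | u
  · rw [sunWeight_inl_inl] at hw
    have : x = u + 1 ∨ u = x + 1 := by by_contra h'; simp [h'] at hw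
    rcases this with rfl | rfl
    · left; simpa using hu
    · right; left; exact hu
  · have : u = x := by by_contra h'; simp [sunWeight, h'] at hw
    right; right; exact this ▸ hu

theorem SunReachable.step {B C : Finset (Fin n ⊕ Fin n)} (hB : SunReachable B)
    (h : stepProb (sunWeight n c) B C ≠ 0) : SunReachable C := by
  have hBC := subset_of_stepProb_ne_zero h
  rcases hB with ⟨⟨h1, h2⟩, hl⟩ | ⟨v, rfl⟩
  · have hnew : ∀ x : Fin n, inl x ∈ C → inl x ∉ B → inl (x - 1) ∈ B ∨ inl (x + 1) ∈ B := by
      intro x hC hB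
      have := neighbor_mem_of_center_mem h hC hB
      have := hl x
      tauto
    refine Or.inl ⟨⟨?_, ?_⟩, ?_⟩
    · exact boundary_unique_of_step (P := fun x => inl x ∈ B) (Q := fun x => inl x ∈ C)
        (f := fun x => x - 1) (g := fun x => x + 1) sub_left_injective (by simp)
        (fun x hx => hBC hx) hnew h1
    · exact boundary_unique_of_step (P := fun x => inl x ∈ B) (Q := fun x => inl x ∈ C)
        (f := fun x => x + 1) (g := fun x => x - 1) (add_left_injective 1) (by simp)
        (fun x hx => hBC hx) (fun x hC hB => (hnew x hC hB).symm) h2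
    · intro x hx
      by_cases hxB : inr x ∈ B
      · exact hBC (hl x hxB)
      · exact hBC (center_mem_of_leaf_mem h hx hxB)
  · have hcen : ∀ x, inl x ∈ C → x = v := by
      intro x hx
      simpa using neighbor_mem_of_center_mem h hx (by simp)
    have hleaf : ∀ x, inr x ∈ C → x = v := by
      intro x hx
      by_contra hxv
      simpa using center_mem_of_leaf_mem h hx (by simpa using hxv)
    by_cases hv : inl v ∈ C
    · refine Or.inl ⟨⟨?_, ?_⟩, ?_⟩
      · intro x y _ hx _ hy
        exact sub_left_injective ((hcen _ hx).trans (hcen _ hy).symm)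
      · intro x y _ hx _ hy
        exact add_left_injective 1 ((hcen _ hx).trans (hcen _ hy).symm)
      · intro x hx
        exact hleaf x hx ▸ hv
    · refine Or.inr ⟨v, Finset.Subset.antisymm ?_ hBC⟩
      rintro (x | x) hx
      · exact absurd (hcen x hx ▸ hx) hv
      · simp [hleaf x hx]

theorem SunReachable.centerDrift_le (hn : 3 ≤ n) (hc : 0 < c) {B : Finset (Fin n ⊕ Fin n)}
    (hB : SunReachable B) : centerDrift c B ≤ 2 / 3 := by
  rw [centerDrift_eq hn hc]
  gcongr
  norm_cast
  rcases hB with ⟨⟨h1, h2⟩, hl⟩ | ⟨v, rfl⟩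
  · have h1' : (Finset.univ.filter fun x => inl x ∉ B ∧ inl (x - 1) ∈ B).card ≤ 1 :=
      Finset.card_le_one.2 fun x hx y hy => by
        simp only [Finset.mem_filter, Finset.mem_univ, true_and] at hx hy
        exact h1 x y hx.1 hx.2 hy.1 hy.2
    have h2' : (Finset.univ.filter fun x => inl x ∉ B ∧ inl (x + 1) ∈ B).card ≤ 1 :=
      Finset.card_le_one.2 fun x hx y hy => by
        simp only [Finset.mem_filter, Finset.mem_univ, true_and] at hx hy
        exact h2 x y hx.1 hx.2 hy.1 hy.2
    have h3 : (Finset.univ.filter fun x => inl x ∉ B ∧ inr x ∈ B).card = 0 := by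
      rw [Finset.card_eq_zero, Finset.filter_eq_empty_iff]
      intro x _ hx
      exact hx.1 (hl x hx.2)
    omega
  · simp [Finset.filter_eq']

theorem SunReachable.sunPotential_le (hn : 3 ≤ n) (hc : 0 < c) {B : Finset (Fin n ⊕ Fin n)}
    (hB : SunReachable B) :
    sunPotential B ≤ ∑ C, stepProb (sunWeight n c) B C * sunPotential C + notFull B := by
  by_cases hfull : ∀ x : Fin n, inl x ∈ B
  · simp [sunPotential, hfull]
  push Not at hfull
  obtain ⟨x, hxc, hxl⟩ : ∃ x, inl x ∉ B ∧ inr x ∉ B := by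
    rcases hB with ⟨-, hl⟩ | ⟨v, rfl⟩
    · exact hfull.imp fun x hx => ⟨hx, mt (hl x) hx⟩
    · have : Nontrivial (Fin n) := Fin.nontrivial_iff_two_le.2 (by omega)
      obtain ⟨y, hy⟩ := exists_ne v
      exact ⟨y, by simp, by simpa using hy⟩
  have hnf : ∑ C, stepProb (sunWeight n c) B C * notFull C = 1 := by
    rw [← sum_stepProb (sunWeight n c) B]
    refine Finset.sum_congr rfl fun C _ => ?_
    by_cases h : stepProb (sunWeight n c) B C = 0
    · simp [h]
    · have : C ≠ Finset.univ := by
        rintro rfl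
        exact hxc (center_mem_of_leaf_mem h (Finset.mem_univ _) hxl)
      simp [notFull, this]
  have hB1 : notFull B = 1 := if_neg (by rintro rfl; simp at hxc)
  rw [sunPotential, hB1]
  calc _ = ∑ C, stepProb (sunWeight n c) B C * sunPotential C + 3 / 2 * centerDrift c B := by
        rw [expected_sunPotential, hnf]
    _ ≤ _ := by
        rw [← three_halves_mul_two_thirds]
        gcongr
        exact hB.centerDrift_le hn hc

theorem sunReachable_singleton (v : Fin n ⊕ Fin n) : SunReachable {v} := by
  rcases v with v | v
  · refine Or.inl ⟨⟨?_, ?_⟩, by simp⟩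
    · intro x y _ hx _ hy
      simp only [Finset.mem_singleton, inl.injEq] at hx hy
      exact sub_left_injective (hx.trans hy.symm)
    · intro x y _ hx _ hy
      simp only [Finset.mem_singleton, inl.injEq] at hx hy
      exact add_left_injective 1 (hx.trans hy.symm)
  · exact Or.inr ⟨v, rfl⟩

theorem sunPotential_le_ept (hn : 3 ≤ n) (hc : 0 < c) (v : Fin n ⊕ Fin n) :
    sunPotential {v} ≤ ept (sunWeight n c) {v} := by
  refine le_ept_of_drift (K := 3 / 2 * n + 1) (sunReachable_singleton v)
    (fun B C hB h => hB.step h) ?_ ?_ (fun B hB => hB.sunPotential_le hn hc)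
  · exact ENNReal.add_ne_top.2 ⟨ENNReal.mul_ne_top
      (ENNReal.div_ne_top (by simp) (by simp)) (by simp), by simp⟩
  · intro B
    by_cases hB : B = Finset.univ
    · simp [hB, sunPotential_univ]
    · have hB1 : notFull B = 1 := if_neg hB
      rw [sunPotential, hB1, one_mul]
      gcongr
      calc _ ≤ ∑ _x : Fin n, (1 : ℝ≥0∞) := Finset.sum_le_sum fun x _ => by split_ifs <;> simp
        _ = n := by simp

omit [NeZero n] in
theorem sunPotential_center (v : Fin n) :
    sunPotential {inl v} = 1 + (3 / 2 : ℝ≥0∞) * ((n - 1 : ℕ) : ℝ≥0∞) := by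
  have h1 : notFull ({inl v} : Finset (Fin n ⊕ Fin n)) = 1 := by
    refine if_neg fun h => ?_
    have := Finset.mem_univ (inr v : Fin n ⊕ Fin n)
    rw [← h] at this
    simp at this
  have h2 : (∑ x : Fin n, if inl x ∈ ({inl v} : Finset (Fin n ⊕ Fin n)) then (0 : ℝ≥0∞) else 1)
      = ((n - 1 : ℕ) : ℝ≥0∞) := by
    simp [Finset.sum_ite, Finset.filter_not, Finset.filter_eq', Finset.card_sdiff]
  rw [sunPotential, h1, h2, add_comm]

omit [NeZero n] in
theorem sunPotential_center_le (u v : Fin n) :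
    sunPotential {inl u} ≤ sunPotential {(inr v : Fin n ⊕ Fin n)} := by
  unfold sunPotential
  gcongr with x
  · simp; split_ifs <;> simp
  · refine (notFull_le_one _).trans (if_neg fun h => ?_).ge
    have := Finset.mem_univ (inl v : Fin n ⊕ Fin n)
    rw [← h] at this
    simp at this

end Sun

end RZF

/-- For the bidirectional Sun graph on `n ≥ 3` centers with
all edge weights equal, `ept_rzf(S_n) = 1 + (3/2)(n - 1)`. -/
theorem rzf_sun_ept (n : ℕ) (hn : 3 ≤ n) (c : ℝ≥0) (hc : 0 < c) :
    RZF.eptMin (sunWeight n c) = 1 + (3 / 2 : ℝ≥0∞) * ((n - 1 : ℕ) : ℝ≥0∞) := by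
  have : NeZero n := ⟨by omega⟩
  have hcen := RZF.sunPotential_center (n := n)
  refine le_antisymm ?_ (le_iInf fun v => ?_)
  · rw [← hcen 0]
    exact (iInf_le _ (Sum.inl 0)).trans (RZF.ept_sun_center_le hn hc 0)
  · refine le_trans ?_ (RZF.sunPotential_le_ept hn hc v)
    rcases v with v | v
    · rw [hcen v]
    · rw [← hcen v]
      exact RZF.sunPotential_center_le v v
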